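/- Let U and Y be complex Hilbert spaces and let Q : U × Y → U × Y be a bounded linear operator that is bijective with bounded inverse, with block components Q₁₁ : U → U, Q₁₂ : Y → U, Q₂₁ : U → Y, Q₂₂ : Y → Y defined by Q(u, y) = (Q₁₁u + Q₁₂y, Q₂₁u + Q₂₂y). Assume: (i) there exists M ≥ 0 such that ‖Q₂₁u‖ ≤ M·‖Q₁₁u‖ for all u ∈ U; and (ii) for every u₁ ∈ U there exist sequences (uₖ) in U and (yₖ) in Y with yₖ → 0 and Q₁₁uₖ + Q₁₂yₖ = u₁ for every k. Then Q₁₁ is bijective, hence boundedly invertible. (Abstract form of Lemma 2.10: invertibility of the (1,1)-block of the boundary-condition transformation, with hypothesis (ii) supplied in the paper by the exponential solutions of the first well-posed system with transfer function tending to 0 and hypothesis (i) by boundedness of the second transfer function.) -/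

import Mathlib

/-- abstract form of Lemma 2.10: let U, Y be complex Hilbert spaces
and Q : U × Y → U × Y a bounded linear operator, bijective with bounded inverse,
with block components Q₁₁, Q₁₂, Q₂₁, Q₂₂ defined by Q(u,y) = (Q₁₁u + Q₁₂y, Q₂₁u + Q₂₂y).
Assume (i) ‖Q₂₁u‖ ≤ M·‖Q₁₁u‖ for all u, and (ii) every u₁ ∈ U can be written as
u₁ = Q₁₁uₖ + Q₁₂yₖ with yₖ → 0. Then Q₁₁ is bijective (hence boundedly invertible). -/
theorem stmt13 {U Y : Type*}
    [NormedAddCommGroup U] [InnerProductSpace ℂ U] [CompleteSpace U]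
    [NormedAddCommGroup Y] [InnerProductSpace ℂ Y] [CompleteSpace Y]
    (Q : (U × Y) ≃L[ℂ] (U × Y))
    (Q₁₁ : U →L[ℂ] U) (Q₁₂ : Y →L[ℂ] U) (Q₂₁ : U →L[ℂ] Y) (Q₂₂ : Y →L[ℂ] Y)
    (hQ : ∀ (u : U) (y : Y), Q (u, y) = (Q₁₁ u + Q₁₂ y, Q₂₁ u + Q₂₂ y))
    (M : ℝ) (hM : 0 ≤ M)
    (hbound : ∀ u : U, ‖Q₂₁ u‖ ≤ M * ‖Q₁₁ u‖)
    (happrox : ∀ u₁ : U, ∃ (uk : ℕ → U) (yk : ℕ → Y),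
      Filter.Tendsto yk Filter.atTop (nhds 0) ∧
      ∀ k : ℕ, Q₁₁ (uk k) + Q₁₂ (yk k) = u₁) :
    Function.Bijective Q₁₁ := by
  have hbelow : ∀ u : U, ‖u‖ ≤ ‖(Q.symm : (U × Y) →L[ℂ] (U × Y))‖ * (1 + M) * ‖Q₁₁ u‖ := by
    intro u
    have hQu : Q (u, 0) = (Q₁₁ u, Q₂₁ u) := by simpa using hQ u 0
    have hnorm : ‖Q (u, 0)‖ ≤ (1 + M) * ‖Q₁₁ u‖ := by
      rw [hQu]
      refine max_le ?_ ?_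
      · nlinarith [norm_nonneg (Q₁₁ u)]
      · nlinarith [norm_nonneg (Q₁₁ u), hbound u]
    calc ‖u‖ ≤ ‖(u, (0 : Y))‖ := le_max_left _ _
      _ = ‖(Q.symm : (U × Y) →L[ℂ] (U × Y)) (Q (u, 0))‖ := by simp
      _ ≤ ‖(Q.symm : (U × Y) →L[ℂ] (U × Y))‖ * ‖Q (u, 0)‖ :=
        ContinuousLinearMap.le_opNorm _ _
      _ ≤ ‖(Q.symm : (U × Y) →L[ℂ] (U × Y))‖ * ((1 + M) * ‖Q₁₁ u‖) := by gcongr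
      _ = _ := by ring
  have hanti : AntilipschitzWith
      ⟨‖(Q.symm : (U × Y) →L[ℂ] (U × Y))‖ * (1 + M), by positivity⟩ Q₁₁ :=
    Q₁₁.antilipschitz_of_bound hbelow
  refine ⟨hanti.injective, fun u₁ => ?_⟩
  have hclosed : IsClosed (Set.range Q₁₁) := hanti.isClosed_range Q₁₁.uniformContinuous
  obtain ⟨uk, yk, hyk, huk⟩ := happrox u₁
  have hlim : Filter.Tendsto (fun k => Q₁₁ (uk k)) Filter.atTop (nhds u₁) := by
    have hsub : Filter.Tendsto (fun k => u₁ - Q₁₂ (yk k)) Filter.atTop (nhds (u₁ - Q₁₂ 0)) :=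
      tendsto_const_nhds.sub ((Q₁₂.continuous.tendsto 0).comp hyk)
    rw [map_zero, sub_zero] at hsub
    exact hsub.congr fun k => (eq_sub_of_add_eq (huk k)).symm
  exact hclosed.mem_of_tendsto hlim (Filter.Eventually.of_forall fun k => ⟨uk k, rfl⟩)
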